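/- Let p > 0 and suppose there exist constants k, K > 0 and exponents q ≥ r ≥ 0 such that k|y|^r ≤ |s(y)| ≤ K|y|^q for all |y| ≥ 1, and suppose p > q. If ∫_ℝ |s(y)| ν(dy) < ∞, ∫_ℝ s(y) ν(dy) = 0 and ∫_ℝ |y|^{p+q-r} ν(dy) < ∞, then ∫_0^∞ z^{p-1}(ν₊(z)+ν₋(z)) dz < ∞. Conversely, if ∫_0^∞ z^{p-1}(ν₊(z)+ν₋(z)) dz < ∞, then ∫_ℝ |y|^p ν(dy) < ∞, ∫_ℝ |s(y)| ν(dy) < ∞ and ∫_ℝ s(y) ν(dy) = 0. -/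

import Mathlib

open MeasureTheory Set Filter
open scoped ENNReal NNReal Classical

/-- The function `c_Y` of the paper: `c_Y y = ∫_{[0,∞)} min(s(y),s(w)) ν(dw)` for `y ≥ 0`,
`c_Y y = ∫_{(-∞,0)} min(|s(y)|,|s(w)|) ν(dw)` for `y < 0`. -/
noncomputable def cY (s : ℝ → ℝ) (ν : Measure ℝ) (y : ℝ) : ℝ :=
  if 0 ≤ y then ∫ w in Ici (0 : ℝ), min (s y) (s w) ∂ν
  else ∫ w in Iio (0 : ℝ), min |s y| |s w| ∂ν

/-- The slope `(c_Y(z) - c_Y(-y))/(s(z) - s(-y))` in the definition of `ζ₊, ρ₊`. -/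
noncomputable def slopeYPlus (s : ℝ → ℝ) (ν : Measure ℝ) (z y : ℝ) : ℝ :=
  (cY s ν z - cY s ν (-y)) / (s z - s (-y))

/-- The slope `(c_Y(y) - c_Y(-z))/(s(y) - s(-z))` in the definition of `ζ₋, ρ₋`. -/
noncomputable def slopeYMinus (s : ℝ → ℝ) (ν : Measure ℝ) (z y : ℝ) : ℝ :=
  (cY s ν y - cY s ν (-z)) / (s y - s (-z))

/-- The set of `y > 0` attaining the infimum in the definition of `ρ₊(z)`. -/
def argYPlus (s : ℝ → ℝ) (ν : Measure ℝ) (z : ℝ) : Set ℝ :=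
  {y | 0 < y ∧ ∀ x, 0 < x → slopeYPlus s ν z y ≤ slopeYPlus s ν z x}

/-- The set of `y > 0` attaining the supremum in the definition of `ρ₋(z)`. -/
def argYMinus (s : ℝ → ℝ) (ν : Measure ℝ) (z : ℝ) : Set ℝ :=
  {y | 0 < y ∧ ∀ x, 0 < x → slopeYMinus s ν z x ≤ slopeYMinus s ν z y}

/-- `ζ₊(z) = -inf_{y>0} (c_Y(z)-c_Y(-y))/(s(z)-s(-y))` if attained, `0` otherwise. -/
noncomputable def zetaPlus (s : ℝ → ℝ) (ν : Measure ℝ) (z : ℝ) : ℝ :=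
  if (argYPlus s ν z).Nonempty then -sInf (slopeYPlus s ν z '' Ioi 0) else 0

/-- `ζ₋(z) = sup_{y>0} (c_Y(y)-c_Y(-z))/(s(y)-s(-z))` if attained, `0` otherwise. -/
noncomputable def zetaMinus (s : ℝ → ℝ) (ν : Measure ℝ) (z : ℝ) : ℝ :=
  if (argYMinus s ν z).Nonempty then sSup (slopeYMinus s ν z '' Ioi 0) else 0

/-- `ν₊(z) = ζ₊(z) + ν([z,∞))`, the tail distribution function of the supremum of the
stopped process for the optimal embedding. -/
noncomputable def nuPlus (s : ℝ → ℝ) (ν : Measure ℝ) (z : ℝ) : ℝ :=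
  zetaPlus s ν z + (ν (Ici z)).toReal

/-- `ν₋(z) = ν((-∞,-z]) + ζ₋(z)`, the tail distribution function of minus the infimum of
the stopped process for the optimal embedding. -/
noncomputable def nuMinus (s : ℝ → ℝ) (ν : Measure ℝ) (z : ℝ) : ℝ :=
  (ν (Iic (-z))).toReal + zetaMinus s ν z

/-- One-sided version of `cY`. -/
noncomputable def cc (S : ℝ → ℝ) (μ : Measure ℝ) (y : ℝ) : ℝ :=
  ∫ w in Ioi (0 : ℝ), min (S y) (S w) ∂μ

/-- maximum if attained, else zero. -/
noncomputable def ZZ (f : ℝ → ℝ) : ℝ :=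
  if ∃ y, 0 < y ∧ ∀ x, 0 < x → f x ≤ f y then sSup (f '' Ioi 0) else 0

theorem ZZ_of_max {f : ℝ → ℝ} {y : ℝ} (hy : 0 < y) (h : ∀ x, 0 < x → f x ≤ f y) : ZZ f = f y := by
  unfold ZZ
  rw [if_pos ⟨y, hy, h⟩]
  apply IsGreatest.csSup_eq
  refine ⟨⟨y, hy, rfl⟩, ?_⟩
  rintro _ ⟨x, hx, rfl⟩
  exact h x hx

theorem ZZ_cases (f : ℝ → ℝ) :
    (∃ y, 0 < y ∧ (∀ x, 0 < x → f x ≤ f y) ∧ ZZ f = f y) ∨ ZZ f = 0 := by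
  by_cases h : ∃ y, 0 < y ∧ ∀ x, 0 < x → f x ≤ f y
  · obtain ⟨y, hy, h⟩ := h
    exact Or.inl ⟨y, hy, h, ZZ_of_max hy h⟩
  · right; unfold ZZ; rw [if_neg h]

section ccfacts
set_option linter.unusedSectionVars false
variable {S : ℝ → ℝ} {μ : Measure ℝ} [IsProbabilityMeasure μ]

theorem cc_integrable (hS : Continuous S) (hm : StrictMono S) (h0 : S 0 = 0)
    (u : ℝ) : IntegrableOn (fun w => min u (S w)) (Ioi 0) μ := by
  apply Measure.integrableOn_of_bounded (M := |u|) (measure_ne_top _ _)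
  · exact (continuous_const.min hS).aestronglyMeasurable
  · refine (ae_restrict_iff' measurableSet_Ioi).2 (Eventually.of_forall fun w hw => ?_)
    have : 0 < S w := by rw [← h0]; exact hm hw
    rw [Real.norm_eq_abs]
    rcases le_total u (S w) with h | h
    · rw [min_eq_left h]
    · rw [min_eq_right h]
      rw [abs_of_pos this]; exact h.trans (le_abs_self u)

theorem spos (hm : StrictMono S) (h0 : S 0 = 0) {w : ℝ} (hw : 0 < w) : 0 < S w := by
  rw [← h0]; exact hm hw

theorem cc_zero (hm : StrictMono S) (h0 : S 0 = 0)
    : cc S μ 0 = 0 := by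
  unfold cc
  rw [setIntegral_congr_fun (g := fun _ => (0:ℝ)) measurableSet_Ioi]
  · simp
  · intro w hw
    have := spos hm h0 hw
    simp only [h0]
    exact min_eq_left this.le

theorem cc_mono (hS : Continuous S) (hm : StrictMono S) (h0 : S 0 = 0)
    {y y' : ℝ} (h : y ≤ y') : cc S μ y ≤ cc S μ y' := by
  unfold cc
  apply setIntegral_mono (cc_integrable hS hm h0 _) (cc_integrable hS hm h0 _)
  intro w
  exact min_le_min_right _ (hm.monotone h)

theorem cc_nonneg (hS : Continuous S) (hm : StrictMono S) (h0 : S 0 = 0)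
    {y : ℝ} (h : 0 ≤ y) : 0 ≤ cc S μ y := by
  rw [← cc_zero (μ := μ) hm h0]; exact cc_mono hS hm h0 h

theorem cc_sub_le (hS : Continuous S) (hm : StrictMono S) (h0 : S 0 = 0)
    {y y' : ℝ} (hy : 0 ≤ y) (h : y ≤ y') :
    cc S μ y' - cc S μ y ≤ (S y' - S y) * μ.real (Ioi y) := by
  unfold cc
  rw [← integral_sub (cc_integrable hS hm h0 _) (cc_integrable hS hm h0 _)]
  have hSS := hm.monotone h
  calc _ ≤ ∫ w in Ioi 0, (Ioi y).indicator (fun _ => S y' - S y) w ∂μ := by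
        apply setIntegral_mono
        · exact (cc_integrable hS hm h0 _).sub (cc_integrable hS hm h0 _)
        · exact ((integrable_const _).indicator measurableSet_Ioi).integrableOn
        · intro w
          by_cases hw : y < w
          · simp only [indicator, mem_Ioi, hw, if_true]
            have := (hm hw).le
            rw [min_eq_left this]
            have := min_le_left (S y') (S w)
            linarith
          · simp only [indicator, mem_Ioi, hw, if_false]
            have := (hm.monotone (not_lt.1 hw))
            rw [min_eq_right this, min_eq_right (this.trans hSS)]
            simp
    _ = _ := by
        rw [setIntegral_indicator measurableSet_Ioi]
        have : Ioi (0:ℝ) ∩ Ioi y = Ioi y := by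
          rw [Ioi_inter_Ioi]; congr 1; exact sup_eq_right.2 hy
        rw [this, setIntegral_const, smul_eq_mul, mul_comm]

theorem cc_le (hS : Continuous S) (hm : StrictMono S) (h0 : S 0 = 0)
    {y : ℝ} (hy : 0 ≤ y) : cc S μ y ≤ S y := by
  have := cc_sub_le (μ := μ) hS hm h0 le_rfl hy
  rw [cc_zero hm h0, h0] at this
  have h1 : μ.real (Ioi 0) ≤ 1 := measureReal_le_one
  have h2 : 0 ≤ S y := by rw [← h0]; exact hm.monotone hy
  nlinarith

theorem cc_continuousOn (hS : Continuous S) (hm : StrictMono S) (h0 : S 0 = 0)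
    : ContinuousOn (cc S μ) (Ici 0) := by
  have key : ∀ y ∈ Ici (0:ℝ), ∀ y' ∈ Ici (0:ℝ), dist (cc S μ y) (cc S μ y') ≤ dist (S y) (S y') := by
    have : ∀ y ∈ Ici (0:ℝ), ∀ y' ∈ Ici (0:ℝ), y ≤ y' → dist (cc S μ y) (cc S μ y') ≤ dist (S y) (S y') := by
      intro y hy y' hy' h
      rw [dist_comm, dist_comm (S y), Real.dist_eq, Real.dist_eq,
        abs_of_nonneg (sub_nonneg.2 (cc_mono hS hm h0 h)),
        abs_of_nonneg (sub_nonneg.2 (hm.monotone h))]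
      have h1 := cc_sub_le (μ := μ) hS hm h0 hy h
      have h2 : μ.real (Ioi y) ≤ 1 := measureReal_le_one
      have h3 := hm.monotone h
      nlinarith
    intro y hy y' hy'
    rcases le_total y y' with h | h
    · exact this y hy y' hy' h
    · rw [dist_comm, dist_comm (S y)]; exact this y' hy' y hy h
  intro x hx
  rw [Metric.continuousWithinAt_iff]
  intro ε hε
  obtain ⟨δ, hδ, H⟩ := Metric.continuous_iff.1 hS x ε hε
  exact ⟨δ, hδ, fun {y} hy hd => (key y hy x hx).trans_lt (H y hd)⟩

theorem cc_le_M (hS : Continuous S) (hm : StrictMono S) (h0 : S 0 = 0)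
    (hi : IntegrableOn S (Ioi 0) μ) (y : ℝ) : cc S μ y ≤ ∫ w in Ioi 0, S w ∂μ := by
  unfold cc
  apply setIntegral_mono (cc_integrable hS hm h0 _) hi
  intro w
  exact min_le_right _ _

theorem M_sub_cc_le (hS : Continuous S) (hm : StrictMono S) (h0 : S 0 = 0)
    (hi : IntegrableOn S (Ioi 0) μ) {y : ℝ} (hy : 0 ≤ y) :
    (∫ w in Ioi 0, S w ∂μ) - cc S μ y ≤ ∫ w in Ioi y, S w ∂μ := by
  unfold cc
  rw [← integral_sub hi (cc_integrable hS hm h0 _)]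
  have hi' : IntegrableOn S (Ioi y) μ := hi.mono_set (Ioi_subset_Ioi hy)
  calc _ ≤ ∫ w in Ioi 0, (Ioi y).indicator S w ∂μ := by
        apply setIntegral_mono_on
        · exact hi.sub (cc_integrable hS hm h0 _)
        · exact ((integrable_indicator_iff measurableSet_Ioi).2 hi').integrableOn
        · exact measurableSet_Ioi
        · intro w hw0
          by_cases hw : y < w
          · simp only [indicator, mem_Ioi, hw, if_true]
            have := (hm hw).le
            rw [min_eq_left this]
            have : 0 ≤ S y := by rw [← h0]; exact hm.monotone hy
            linarith
          · simp only [indicator, mem_Ioi, hw, if_false]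
            have := (hm.monotone (not_lt.1 hw))
            rw [min_eq_right this]
            simp
    _ = _ := by
        rw [setIntegral_indicator measurableSet_Ioi]
        have : Ioi (0:ℝ) ∩ Ioi y = Ioi y := by
          rw [Ioi_inter_Ioi]; congr 1; exact sup_eq_right.2 hy
        rw [this]

theorem cc_tendsto (hS : Continuous S) (hm : StrictMono S) (h0 : S 0 = 0)
    (hi : IntegrableOn S (Ioi 0) μ) :
    Tendsto (cc S μ) atTop (nhds (∫ w in Ioi 0, S w ∂μ)) := by
  unfold cc
  apply tendsto_integral_filter_of_dominated_convergence (fun w => S w)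
  · exact Eventually.of_forall fun n => (cc_integrable hS hm h0 _).aestronglyMeasurable
  · filter_upwards [eventually_ge_atTop 0] with n hn
    refine (ae_restrict_iff' measurableSet_Ioi).2 (Eventually.of_forall fun w hw => ?_)
    have h1 := spos hm h0 hw
    have h2 : 0 ≤ S n := by rw [← h0]; exact hm.monotone hn
    rw [Real.norm_eq_abs, abs_of_nonneg (le_min h2 h1.le)]
    exact min_le_right _ _
  · exact hi
  · refine Eventually.of_forall fun w => ?_
    apply tendsto_const_nhds.congr'
    filter_upwards [eventually_ge_atTop w] with n hn
    rw [min_eq_right (hm.monotone hn)]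

theorem tail_tendsto : Tendsto (fun y => μ.real (Ioi y)) atTop (nhds 0) := by
  have h := tendsto_measure_iInter_atTop (μ := μ) (s := fun y : ℝ => Ioi y)
    (fun i => measurableSet_Ioi.nullMeasurableSet) (fun a b h => Ioi_subset_Ioi h)
    ⟨0, measure_ne_top _ _⟩
  have he : (⋂ n : ℝ, Ioi n) = ∅ := by
    ext x; simp only [mem_iInter, mem_Ioi, mem_empty_iff_false, iff_false, not_forall]
    exact ⟨x, lt_irrefl x⟩
  rw [he, measure_empty] at h
  have := (ENNReal.tendsto_toReal ENNReal.zero_ne_top).comp h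
  rw [ENNReal.toReal_zero] at this
  exact this

/-- The slope function. -/
noncomputable def sl (S T : ℝ → ℝ) (μ μ' : Measure ℝ) (z y : ℝ) : ℝ :=
  (cc S μ y - cc T μ' z) / (S y + T z)

variable {T : ℝ → ℝ} {μ' : Measure ℝ} [IsProbabilityMeasure μ']

theorem ZZ_nonneg (hS : Continuous S) (hm : StrictMono S) (h0 : S 0 = 0) (hmT : StrictMono T) (hT0 : T 0 = 0)
    {z : ℝ} (hz : 0 < z) : 0 ≤ ZZ (sl S T μ μ' z) := by
  rcases ZZ_cases (sl S T μ μ' z) with ⟨y, hy, hmax, he⟩ | he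
  · rw [he]
    by_contra hneg
    push Not at hneg
    have h1 := hmax (y + 1) (by linarith)
    have hTz := spos hmT hT0 hz
    have hSy := spos hm h0 hy
    have hSy1 : S y < S (y + 1) := hm (by linarith)
    have hc := cc_mono (μ := μ) hS hm h0 (show y ≤ y + 1 by linarith)
    set m := sl S T μ μ' z y with hmdef
    have e1 : cc S μ y - cc T μ' z = m * (S y + T z) := by
      rw [hmdef]; unfold sl; field_simp
    have e2 : cc S μ (y+1) - cc T μ' z ≤ m * (S (y+1) + T z) := by
      unfold sl at h1
      rwa [div_le_iff₀ (by linarith)] at h1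
    nlinarith
  · rw [he]

theorem ZZ_le_one (hS : Continuous S) (hm : StrictMono S) (h0 : S 0 = 0) (hT : Continuous T) (hmT : StrictMono T) (hT0 : T 0 = 0)
    {z : ℝ} (hz : 0 < z) : ZZ (sl S T μ μ' z) ≤ 1 := by
  rcases ZZ_cases (sl S T μ μ' z) with ⟨y, hy, hmax, he⟩ | he
  · rw [he]
    have hTz := spos hmT hT0 hz
    have hSy := spos hm h0 hy
    unfold sl
    rw [div_le_one (by linarith)]
    have := cc_le (μ := μ) hS hm h0 hy.le
    have := cc_nonneg (μ := μ') hT hmT hT0 hz.le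
    linarith
  · rw [he]; exact zero_le_one

theorem ZZ_le_tail (hS : Continuous S) (hm : StrictMono S) (h0 : S 0 = 0) (hT : Continuous T) (hmT : StrictMono T) (hT0 : T 0 = 0)
    {z : ℝ} (hz : 0 < z) (hi : IntegrableOn S (Ioi 0) μ)
    (hi' : IntegrableOn T (Ioi 0) μ') (hM : ∫ w in Ioi 0, S w ∂μ = ∫ w in Ioi 0, T w ∂μ') :
    ZZ (sl S T μ μ' z) ≤ (∫ w in Ioi z, T w ∂μ') / T z := by
  have hTz := spos hmT hT0 hz
  have hnn : 0 ≤ ∫ w in Ioi z, T w ∂μ' :=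
    setIntegral_nonneg measurableSet_Ioi fun w hw => (spos hmT hT0 (hz.trans hw)).le
  rcases ZZ_cases (sl S T μ μ' z) with ⟨y, hy, hmax, he⟩ | he
  · rw [he]
    have hSy := spos hm h0 hy
    unfold sl
    have h1 := cc_le_M (μ := μ) hS hm h0 hi y
    have h2 := M_sub_cc_le (μ := μ') hT hmT hT0 hi' hz.le
    exact div_le_div₀ hnn (by linarith) hTz (by linarith)
  · rw [he]; positivity

theorem ZZ_lower (hS : Continuous S) (hm : StrictMono S) (h0 : S 0 = 0) (hT : Continuous T) (hmT : StrictMono T) (hT0 : T 0 = 0)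
    {z : ℝ} (hz : 0 < z) {y₀ ε : ℝ} (hy₀ : 0 < y₀) (hε : 0 < ε)
    (h : cc T μ' z + ε ≤ cc S μ y₀) : ε / (S y₀ + T z) ≤ ZZ (sl S T μ μ' z) := by
  have hTz := spos hmT hT0 hz
  have hSy₀ := spos hm h0 hy₀
  have hden : ∀ y, 0 ≤ y → 0 < S y + T z := by
    intro y hy
    have : 0 ≤ S y := by rw [← h0]; exact hm.monotone hy
    linarith
  have hf0 : ε / (S y₀ + T z) ≤ sl S T μ μ' z y₀ := by
    unfold sl
    apply div_le_div_of_nonneg_right _ (hden y₀ hy₀.le).le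
    linarith
  have hpos : 0 < ε / (S y₀ + T z) := div_pos hε (hden y₀ hy₀.le)
  obtain ⟨y₁, hy₁, htail⟩ := ((eventually_ge_atTop y₀).and
    ((tail_tendsto (μ := μ)).eventually_lt_const hpos)).exists
  have hcont : ContinuousOn (sl S T μ μ' z) (Icc 0 y₁) := by
    unfold sl
    apply ContinuousOn.div
    · exact ((cc_continuousOn hS hm h0).mono Icc_subset_Ici_self).sub continuousOn_const
    · exact (hS.continuousOn).add continuousOn_const
    · intro x hx; exact (hden x hx.1).ne'
  obtain ⟨y, hy, hmax⟩ := isCompact_Icc.exists_isMaxOn (nonempty_Icc.2 (hy₀.le.trans hy₁)) hcont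
  have hym : sl S T μ μ' z y₀ ≤ sl S T μ μ' z y := hmax ⟨hy₀.le, hy₁⟩
  have hypos : 0 < y := by
    rcases hy.1.lt_or_eq with h | h
    · exact h
    · exfalso
      have : sl S T μ μ' z 0 ≤ 0 := by
        unfold sl
        apply div_nonpos_of_nonpos_of_nonneg
        · rw [cc_zero hm h0]
          have := cc_nonneg (μ := μ') hT hmT hT0 hz.le
          linarith
        · exact (hden 0 le_rfl).le
      rw [← h] at hym
      linarith
  rw [ZZ_of_max hypos]
  · linarith
  · intro x hx
    rcases le_total x y₁ with hx1 | hx1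
    · exact hmax ⟨hx.le, hx1⟩
    · have h1 : sl S T μ μ' z y₁ ≤ sl S T μ μ' z y := hmax ⟨hy₀.le.trans hy₁, le_rfl⟩
      have h2 := cc_sub_le (μ := μ) hS hm h0 (hy₀.le.trans hy₁) hx1
      have h3 := hm.monotone hx1
      set m := sl S T μ μ' z y
      unfold sl at h1 ⊢
      rw [div_le_iff₀ (hden _ (hy₀.le.trans hy₁))] at h1
      rw [div_le_iff₀ (hden _ hx.le)]
      have h4 : (S x - S y₁) * μ.real (Ioi y₁) ≤ (S x - S y₁) * m :=
        mul_le_mul_of_nonneg_left (by linarith) (by linarith)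
      nlinarith

end ccfacts
theorem ZZ_congr {f g : ℝ → ℝ} (h : ∀ y, 0 < y → f y = g y) : ZZ f = ZZ g := by
  rcases ZZ_cases f with ⟨y, hy, hmax, he⟩ | he
  · rw [he, ZZ_of_max (f := g) hy, h y hy]
    intro x hx
    rw [← h x hx, ← h y hy]; exact hmax x hx
  · rcases ZZ_cases g with ⟨y, hy, hmax, he'⟩ | he'
    · rw [he', ZZ_of_max (f := f) hy, h y hy]
      intro x hx
      rw [h x hx, h y hy]; exact hmax x hx
    · rw [he, he']

/-- reflected scale function -/
def rfs (s : ℝ → ℝ) : ℝ → ℝ := fun x => -s (-x)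

theorem cY_pos (s : ℝ → ℝ) (ν : Measure ℝ) (hν0 : ν {0} = 0) {y : ℝ} (hy : 0 ≤ y) :
    cY s ν y = cc s ν y := by
  unfold cY cc
  rw [if_pos hy]
  exact setIntegral_congr_set (Ioi_ae_eq_Ici' hν0).symm

theorem cY_neg (s : ℝ → ℝ) (hs : Continuous s) (hm : StrictMono s) (h0 : s 0 = 0)
    (ν : Measure ℝ) {y : ℝ} (hy : 0 < y) :
    cY s ν (-y) = cc (rfs s) (ν.map Neg.neg) y := by
  unfold cY cc rfs
  rw [if_neg (by linarith), setIntegral_map measurableSet_Ioi _ measurable_neg.aemeasurable]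
  · have : (Neg.neg ⁻¹' Ioi (0:ℝ)) = Iio 0 := by ext x; simp
    rw [this]
    apply setIntegral_congr_fun measurableSet_Iio
    intro w hw
    have h1 : s w < 0 := by rw [← h0]; exact hm hw
    have h2 : s (-y) < 0 := by rw [← h0]; exact hm (by linarith)
    simp only [abs_of_neg h1, abs_of_neg h2, neg_neg]
  · apply Continuous.aestronglyMeasurable
    fun_prop

theorem zetaMinus_eq (s : ℝ → ℝ) (hs : Continuous s) (hm : StrictMono s) (h0 : s 0 = 0)
    (ν : Measure ℝ) (hν0 : ν {0} = 0) {z : ℝ} (hz : 0 < z) :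
    zetaMinus s ν z = ZZ (sl s (rfs s) ν (ν.map Neg.neg) z) := by
  have : zetaMinus s ν z = ZZ (slopeYMinus s ν z) := rfl
  rw [this]
  apply ZZ_congr
  intro y hy
  unfold slopeYMinus sl
  rw [cY_pos s ν hν0 hy.le, cY_neg s hs hm h0 ν hz]
  unfold rfs
  rw [sub_eq_add_neg (s y)]

theorem zetaPlus_eq (s : ℝ → ℝ) (hs : Continuous s) (hm : StrictMono s) (h0 : s 0 = 0)
    (ν : Measure ℝ) (hν0 : ν {0} = 0) {z : ℝ} (hz : 0 < z) :
    zetaPlus s ν z = ZZ (sl (rfs s) s (ν.map Neg.neg) ν z) := by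
  have : zetaPlus s ν z = ZZ (fun y => - slopeYPlus s ν z y) := by
    unfold zetaPlus ZZ
    have e : (argYPlus s ν z).Nonempty ↔ ∃ y, 0 < y ∧ ∀ x, 0 < x →
        -slopeYPlus s ν z x ≤ -slopeYPlus s ν z y := by
      unfold argYPlus Set.Nonempty
      simp
    by_cases h : (argYPlus s ν z).Nonempty
    · rw [if_pos h, if_pos (e.1 h), Real.sInf_def, neg_neg]
      congr 1
      rw [← Set.image_neg_eq_neg, Set.image_image]
    · rw [if_neg h, if_neg (fun h' => h (e.2 h'))]
  rw [this]
  apply ZZ_congr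
  intro y hy
  unfold slopeYPlus sl
  rw [cY_pos s ν hν0 hz.le, cY_neg s hs hm h0 ν hy]
  unfold rfs
  rw [← neg_div]
  congr 1 <;> ring

theorem rfs_mono {s : ℝ → ℝ} (hm : StrictMono s) : StrictMono (rfs s) := by
  intro a b h
  unfold rfs
  have := hm (neg_lt_neg h)
  linarith

theorem rfs_cont {s : ℝ → ℝ} (hs : Continuous s) : Continuous (rfs s) := by
  unfold rfs; fun_prop

theorem rfs_zero {s : ℝ → ℝ} (h0 : s 0 = 0) : rfs s 0 = 0 := by
  unfold rfs; simp [h0]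

theorem meas_abs (ν : Measure ℝ) {z : ℝ} (hz : 0 < z) :
    ν {w | z ≤ |w|} = ν (Ici z) + ν (Iic (-z)) := by
  rw [← measure_union _ measurableSet_Iic]
  · congr 1
    ext w
    simp only [mem_ofPred_eq, mem_union, mem_Ici, mem_Iic, le_abs]
    constructor
    · rintro (h | h)
      · exact Or.inl h
      · right; linarith
    · rintro (h | h)
      · exact Or.inl h
      · right; linarith
  · rw [Set.disjoint_left]
    intro w h1 h2
    simp only [mem_Ici, mem_Iic] at h1 h2
    linarith

theorem integrand_eq (s : ℝ → ℝ) (hs : Continuous s) (hm : StrictMono s) (h0 : s 0 = 0)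
    (ν : Measure ℝ) [IsProbabilityMeasure ν] (hν0 : ν {0} = 0) {z : ℝ} (hz : 0 < z) (p : ℝ) :
    ENNReal.ofReal (z ^ (p - 1) * (nuPlus s ν z + nuMinus s ν z)) =
      ENNReal.ofReal (z ^ (p - 1)) * (ν {w | z ≤ |w|} +
        ENNReal.ofReal (ZZ (sl (rfs s) s (ν.map Neg.neg) ν z)) +
        ENNReal.ofReal (ZZ (sl s (rfs s) ν (ν.map Neg.neg) z))) := by
  have : IsProbabilityMeasure (ν.map Neg.neg) :=
    Measure.isProbabilityMeasure_map measurable_neg.aemeasurable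
  have n1 := ZZ_nonneg (μ := ν) (μ' := ν.map Neg.neg) hs hm h0 (rfs_mono hm) (rfs_zero h0) hz
  have n2 := ZZ_nonneg (μ := ν.map Neg.neg) (μ' := ν) (rfs_cont hs) (rfs_mono hm)
    (rfs_zero h0) hm h0 hz
  rw [ENNReal.ofReal_mul (by positivity)]
  congr 1
  unfold nuPlus nuMinus
  rw [zetaPlus_eq s hs hm h0 ν hν0 hz, zetaMinus_eq s hs hm h0 ν hν0 hz, meas_abs ν hz]
  rw [ENNReal.ofReal_add (by positivity) (by positivity), ENNReal.ofReal_add n2 (by positivity),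
    ENNReal.ofReal_add (by positivity) n1, ENNReal.ofReal_toReal (measure_ne_top _ _),
    ENNReal.ofReal_toReal (measure_ne_top _ _)]
  ring

theorem fwd_tail {S T : ℝ → ℝ} (hS : Continuous S) (hm : StrictMono S) (h0 : S 0 = 0)
    (hT : Continuous T) (hmT : StrictMono T) (hT0 : T 0 = 0)
    {μ μ' : Measure ℝ} [IsProbabilityMeasure μ] [IsProbabilityMeasure μ']
    (hi : IntegrableOn S (Ioi 0) μ)
    (hi' : IntegrableOn T (Ioi 0) μ') (hM : ∫ w in Ioi 0, S w ∂μ = ∫ w in Ioi 0, T w ∂μ')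
    {k K q r : ℝ} (hk : 0 < k) (hK : 0 < K)
    (hb : ∀ w, 1 ≤ w → k * w ^ r ≤ T w ∧ T w ≤ K * w ^ q) {z : ℝ} (hz : 1 < z) :
    ENNReal.ofReal (ZZ (sl S T μ μ' z)) ≤
      ENNReal.ofReal (K / k) * ENNReal.ofReal (z ^ (-r)) *
        ∫⁻ w in {w | z ≤ |w|}, ENNReal.ofReal (|w| ^ q) ∂μ' := by
  have hz0 : 0 < z := by linarith
  have h1 := ZZ_le_tail hS hm h0 hT hmT hT0 hz0 hi hi' hM
  have hiz : IntegrableOn T (Ioi z) μ' := hi'.mono_set (Ioi_subset_Ioi hz0.le)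
  have hnn : 0 ≤ ∫ w in Ioi z, T w ∂μ' :=
    setIntegral_nonneg measurableSet_Ioi fun w hw => (spos hmT hT0 (hz0.trans hw)).le
  have hzr : 0 < z ^ r := by positivity
  have h2 : (∫ w in Ioi z, T w ∂μ') / T z ≤ (1 / k) * z ^ (-r) * ∫ w in Ioi z, T w ∂μ' := by
    have hb1 := (hb z hz.le).1
    have : (1 / k) * z ^ (-r) * ∫ w in Ioi z, T w ∂μ' = (∫ w in Ioi z, T w ∂μ') / (k * z ^ r) := by
      rw [Real.rpow_neg hz0.le]; field_simp
    rw [this]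
    exact div_le_div_of_nonneg_left hnn (by positivity) hb1
  refine (ENNReal.ofReal_le_ofReal (h1.trans h2)).trans ?_
  rw [ENNReal.ofReal_mul (by positivity), ofReal_integral_eq_lintegral_ofReal hiz]
  · have h3 : ∫⁻ w in Ioi z, ENNReal.ofReal (T w) ∂μ' ≤
        ENNReal.ofReal K * ∫⁻ w in {w | z ≤ |w|}, ENNReal.ofReal (|w| ^ q) ∂μ' := by
      calc _ ≤ ∫⁻ w in Ioi z, ENNReal.ofReal K * ENNReal.ofReal (|w| ^ q) ∂μ' := by
            apply setLIntegral_mono' measurableSet_Ioi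
            intro w hw
            have hw : z < w := hw
            rw [← ENNReal.ofReal_mul hK.le, abs_of_pos (hz0.trans hw)]
            exact ENNReal.ofReal_le_ofReal (hb w (by linarith)).2
        _ = ENNReal.ofReal K * ∫⁻ w in Ioi z, ENNReal.ofReal (|w| ^ q) ∂μ' := by
            rw [lintegral_const_mul' _ _ ENNReal.ofReal_ne_top]
        _ ≤ _ := by
            gcongr
            intro w hw
            have hw : z < w := hw
            exact hw.le.trans (le_abs_self w)
    refine (mul_le_mul_right h3 _).trans (le_of_eq ?_)
    rw [← mul_assoc]
    congr 1
    rw [← ENNReal.ofReal_mul (by positivity), ← ENNReal.ofReal_mul (by positivity)]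
    congr 1
    field_simp
  · exact (ae_restrict_iff' measurableSet_Ioi).2 (Eventually.of_forall fun w hw =>
      (spos hmT hT0 (hz0.trans hw)).le)

theorem conv_top {S T : ℝ → ℝ} (hS : Continuous S) (hm : StrictMono S) (h0 : S 0 = 0)
    (hT : Continuous T) (hmT : StrictMono T) (hT0 : T 0 = 0)
    {μ μ' : Measure ℝ} [IsProbabilityMeasure μ] [IsProbabilityMeasure μ']
    (hi : IntegrableOn S (Ioi 0) μ)
    (hi' : IntegrableOn T (Ioi 0) μ') (hM : ∫ w in Ioi 0, T w ∂μ' < ∫ w in Ioi 0, S w ∂μ)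
    {K p q : ℝ} (hK : 0 < K) (hq : 0 ≤ q) (hpq : q < p)
    (hb : ∀ w, 1 ≤ w → T w ≤ K * w ^ q) :
    ∫⁻ z in Ioi 1, ENNReal.ofReal (z ^ (p - 1)) * ENNReal.ofReal (ZZ (sl S T μ μ' z)) = ⊤ := by
  obtain ⟨m, hm1, hm2⟩ := exists_between hM
  obtain ⟨y₀, hy₀, hc⟩ := ((eventually_gt_atTop 0).and
    ((cc_tendsto hS hm h0 hi).eventually_const_lt hm2)).exists
  set ε := m - ∫ w in Ioi 0, T w ∂μ' with hε
  have hεpos : 0 < ε := by linarith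
  have hSy := spos hm h0 hy₀
  set c := ε / (S y₀ + K) with hcdef
  have hcpos : 0 < c := by positivity
  by_contra hne
  have hle : ∫⁻ z in Ioi 1, ENNReal.ofReal (c * z ^ (p - 1 - q)) ≤
      ∫⁻ z in Ioi 1, ENNReal.ofReal (z ^ (p - 1)) * ENNReal.ofReal (ZZ (sl S T μ μ' z)) := by
    apply setLIntegral_mono' measurableSet_Ioi
    intro z hz
    have hz : 1 < z := hz
    have hz0 : 0 < z := by linarith
    rw [← ENNReal.ofReal_mul (by positivity)]
    apply ENNReal.ofReal_le_ofReal
    have h1 := ZZ_lower (μ := μ) (μ' := μ') hS hm h0 hT hmT hT0 hz0 hy₀ hεpos (by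
      have := cc_le_M (μ := μ') hT hmT hT0 hi' z
      linarith)
    have hzq : 1 ≤ z ^ q := Real.one_le_rpow hz.le hq
    have h2 : c / z ^ q ≤ ε / (S y₀ + T z) := by
      rw [hcdef, div_div]
      apply div_le_div_of_nonneg_left hεpos.le
      · have := spos hmT hT0 hz0
        linarith
      · have := hb z hz.le
        nlinarith
    rw [Real.rpow_sub hz0]
    have : c * (z ^ (p - 1) / z ^ q) = z ^ (p - 1) * (c / z ^ q) := by ring
    rw [this]
    exact mul_le_mul_of_nonneg_left (h2.trans h1) (by positivity)
  have hfin : ∫⁻ z in Ioi 1, ENNReal.ofReal (c * z ^ (p - 1 - q)) ≠ ⊤ :=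
    ne_top_of_le_ne_top hne hle
  rw [lintegral_ofReal_ne_top_iff_integrable] at hfin
  · have h3 : IntegrableOn (fun z : ℝ => z ^ (p - 1 - q)) (Ioi 1) := by
      have := hfin.const_mul c⁻¹
      refine this.congr (Eventually.of_forall fun z => ?_)
      simp only
      field_simp
    rw [integrableOn_Ioi_rpow_iff one_pos] at h3
    linarith
  · apply Measurable.aestronglyMeasurable
    fun_prop
  · refine (ae_restrict_iff' measurableSet_Ioi).2 (Eventually.of_forall fun w hw => ?_)
    have hw : 1 < w := hw
    have : 0 < w := by linarith
    simp only [Pi.zero_apply]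
    positivity
theorem rfs_integrable {s : ℝ → ℝ} (hs : Continuous s) {ν : Measure ℝ} (hi : Integrable s ν) :
    Integrable (rfs s) (ν.map Neg.neg) := by
  rw [integrable_map_measure (rfs_cont hs).aestronglyMeasurable measurable_neg.aemeasurable]
  refine hi.neg.congr (Eventually.of_forall fun x => ?_)
  simp [rfs]

theorem integral_split {s : ℝ → ℝ} (hs : Continuous s) {ν : Measure ℝ} (hν0 : ν {0} = 0)
    (hi : Integrable s ν) :
    ∫ y, s y ∂ν = (∫ y in Ioi 0, s y ∂ν) - ∫ y in Ioi 0, rfs s y ∂(ν.map Neg.neg) := by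
  rw [setIntegral_map measurableSet_Ioi (rfs_cont hs).aestronglyMeasurable
    measurable_neg.aemeasurable]
  have : (Neg.neg ⁻¹' Ioi (0:ℝ)) = Iio 0 := by ext x; simp
  rw [this]
  simp only [rfs, neg_neg]
  rw [integral_neg, sub_neg_eq_add, setIntegral_congr_set (Iio_ae_eq_Iic' hν0),
    ← integral_add_compl (measurableSet_Ioi (a := (0:ℝ))) hi, compl_Ioi]

theorem layer (μ : Measure ℝ) {a : ℝ} (ha : 0 < a)
    (h : ∫⁻ y, ENNReal.ofReal (|y| ^ a) ∂μ < ⊤) :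
    ∫⁻ z in Ioi (0:ℝ), μ {w | z ≤ |w|} * ENNReal.ofReal (z ^ (a - 1)) < ⊤ := by
  rw [lintegral_rpow_eq_lintegral_meas_le_mul μ (Eventually.of_forall fun y => abs_nonneg y)
    measurable_norm.aemeasurable ha] at h
  exact ENNReal.lt_top_of_mul_ne_top_right h.ne (ENNReal.ofReal_pos.2 ha).ne'

theorem moment_le (ν : Measure ℝ) [IsProbabilityMeasure ν] {a b : ℝ} (ha : 0 ≤ a) (hab : a ≤ b)
    (h : ∫⁻ y, ENNReal.ofReal (|y| ^ b) ∂ν < ⊤) : ∫⁻ y, ENNReal.ofReal (|y| ^ a) ∂ν < ⊤ := by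
  calc _ ≤ ∫⁻ y, (1 + ENNReal.ofReal (|y| ^ b)) ∂ν := by
        apply lintegral_mono
        intro y
        simp only
        rw [← ENNReal.ofReal_one, ← ENNReal.ofReal_add zero_le_one (by positivity)]
        apply ENNReal.ofReal_le_ofReal
        rcases le_total |y| 1 with hy | hy
        · have := Real.rpow_le_one (abs_nonneg y) hy ha
          have : 0 ≤ |y| ^ b := by positivity
          linarith
        · have := Real.rpow_le_rpow_of_exponent_le hy hab
          linarith
    _ < ⊤ := by
        rw [lintegral_add_left measurable_const]
        simp [h]

theorem meas_meas (μ : Measure ℝ) (a : ℝ) :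
    Measurable fun z : ℝ => μ {w | z ≤ |w|} * ENNReal.ofReal (z ^ (a - 1)) := by
  apply Measurable.mul
  · apply Antitone.measurable
    intro x y h
    exact measure_mono fun w hw => h.trans hw
  · fun_prop

/-- Theorem 4(i) of the paper: case `p > q` under the polynomial growth
bounds `k|y|^r ≤ |s(y)| ≤ K|y|^q` for `|y| ≥ 1`. -/
theorem Hp_embedding_polynomial_scale_p_gt_q
    (s : ℝ → ℝ) (hs : Continuous s) (hmono : StrictMono s) (hs0 : s 0 = 0)
    (ν : Measure ℝ) [IsProbabilityMeasure ν] (hν0 : ν {0} = 0)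
    (p q r k K : ℝ) (hp : 0 < p) (hk : 0 < k) (hK : 0 < K)
    (hr : 0 ≤ r) (hrq : r ≤ q) (hpq : q < p)
    (hbound : ∀ y : ℝ, 1 ≤ |y| → k * |y| ^ r ≤ |s y| ∧ |s y| ≤ K * |y| ^ q) :
    ((Integrable s ν ∧ ∫ y, s y ∂ν = 0 ∧
        ∫⁻ y, ENNReal.ofReal (|y| ^ (p + q - r)) ∂ν < ⊤) →
      ∫⁻ z in Ioi (0 : ℝ), ENNReal.ofReal
        (z ^ (p - 1) * (nuPlus s ν z + nuMinus s ν z)) < ⊤) ∧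
    ((∫⁻ z in Ioi (0 : ℝ), ENNReal.ofReal
        (z ^ (p - 1) * (nuPlus s ν z + nuMinus s ν z)) < ⊤) →
      ∫⁻ y, ENNReal.ofReal (|y| ^ p) ∂ν < ⊤ ∧ Integrable s ν ∧ ∫ y, s y ∂ν = 0) := by
  have hprob : IsProbabilityMeasure (ν.map Neg.neg) :=
    Measure.isProbabilityMeasure_map measurable_neg.aemeasurable
  have hq : 0 ≤ q := hr.trans hrq
  have hbS : ∀ w, 1 ≤ w → k * w ^ r ≤ s w ∧ s w ≤ K * w ^ q := by
    intro w hw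
    have h := hbound w (by rwa [abs_of_nonneg (by linarith)])
    rwa [abs_of_nonneg (by linarith : 0 ≤ w), abs_of_pos (spos hmono hs0 (by linarith))] at h
  have hbT : ∀ w, 1 ≤ w → k * w ^ r ≤ rfs s w ∧ rfs s w ≤ K * w ^ q := by
    intro w hw
    have h := hbound (-w) (by rwa [abs_neg, abs_of_nonneg (by linarith)])
    have hneg : s (-w) < 0 := by rw [← hs0]; exact hmono (by linarith)
    rwa [abs_neg, abs_of_nonneg (by linarith : 0 ≤ w), abs_of_neg hneg] at h
  have hT := rfs_cont hs
  have hmT := rfs_mono hmono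
  have hT0 := rfs_zero hs0
  constructor
  · rintro ⟨hi, hcent, hmom⟩
    have hi1 : IntegrableOn s (Ioi 0) ν := hi.integrableOn
    have hi2 : IntegrableOn (rfs s) (Ioi 0) (ν.map Neg.neg) := (rfs_integrable hs hi).integrableOn
    have hM : ∫ w in Ioi 0, s w ∂ν = ∫ w in Ioi 0, rfs s w ∂(ν.map Neg.neg) := by
      have := integral_split hs hν0 hi
      linarith
    have hpm := moment_le ν hp.le (by linarith : p ≤ p + q - r) hmom
    have hL1 := layer ν hp hpm
    set d : ℝ → ℝ≥0∞ := fun w => ENNReal.ofReal (|w| ^ q) with hd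
    have hdm : Measurable d := by rw [hd]; fun_prop
    have hqm : ∫⁻ y, ENNReal.ofReal (|y| ^ (p - r)) ∂(ν.withDensity d) < ⊤ := by
      rw [lintegral_withDensity_eq_lintegral_mul ν hdm (by fun_prop)]
      refine lt_of_le_of_lt (lintegral_mono fun y => ?_) hmom
      simp only [Pi.mul_apply, hd]
      rw [← ENNReal.ofReal_mul (by positivity)]
      apply ENNReal.ofReal_le_ofReal
      rcases (abs_nonneg y).lt_or_eq with h | h
      · rw [← Real.rpow_add h]
        apply le_of_eq; congr 1; ring
      · rw [← h, Real.zero_rpow (by linarith : p - r ≠ 0), mul_zero]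
        positivity
    have hL2 := layer (ν.withDensity d) (by linarith : 0 < p - r) hqm
    have habs : ∀ z : ℝ, MeasurableSet {w : ℝ | z ≤ |w|} := fun z =>
      measurableSet_le measurable_const measurable_norm
    have hwd : ∀ z : ℝ, ∫⁻ w in {w | z ≤ |w|}, ENNReal.ofReal (|w| ^ q) ∂ν =
        ν.withDensity d {w | z ≤ |w|} := fun z => (withDensity_apply _ (habs z)).symm
    have hwd' : ∀ z : ℝ, ∫⁻ w in {w | z ≤ |w|}, ENNReal.ofReal (|w| ^ q) ∂(ν.map Neg.neg) =
        ν.withDensity d {w | z ≤ |w|} := by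
      intro z
      rw [setLIntegral_map (habs z) hdm measurable_neg, ← hwd]
      simp [hd]
    rw [← Ioc_union_Ioi_eq_Ioi (zero_le_one (α := ℝ))]
    refine (lintegral_union_le _ _ _).trans_lt (ENNReal.add_lt_top.2 ⟨?_, ?_⟩)
    · have hint : IntegrableOn (fun z : ℝ => 3 * z ^ (p - 1)) (Ioc 0 1) := by
        have := intervalIntegral.intervalIntegrable_rpow' (a := 0) (b := 1)
          (by linarith : -1 < p - 1)
        rw [intervalIntegrable_iff_integrableOn_Ioc_of_le zero_le_one] at this
        exact this.const_mul 3
      have hfin := hint.lintegral_lt_top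
      refine lt_of_le_of_lt (setLIntegral_mono' measurableSet_Ioc fun z hz => ?_) hfin
      have hz0 : 0 < z := hz.1
      rw [integrand_eq s hs hmono hs0 ν hν0 hz0, mul_comm (3:ℝ),
        ENNReal.ofReal_mul (by have := hz0.le; positivity)]
      gcongr
      have e : ENNReal.ofReal 3 = 1 + 1 + 1 := by norm_num
      rw [e]
      gcongr
      · exact prob_le_one
      · rw [ENNReal.ofReal_le_one]
        exact ZZ_le_one hT hmT hT0 hs hmono hs0 hz0
      · rw [ENNReal.ofReal_le_one]
        exact ZZ_le_one hs hmono hs0 hT hmT hT0 hz0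
    · set C := 2 * ENNReal.ofReal (K / k) with hC
      calc _ ≤ ∫⁻ z in Ioi (1:ℝ), (ν {w | z ≤ |w|} * ENNReal.ofReal (z ^ (p - 1)) +
              C * (ν.withDensity d {w | z ≤ |w|} * ENNReal.ofReal (z ^ (p - r - 1)))) := by
            apply setLIntegral_mono' measurableSet_Ioi
            intro z hz
            have hz : 1 < z := hz
            have hz0 : 0 < z := by linarith
            rw [integrand_eq s hs hmono hs0 ν hν0 hz0]
            have b1 := fwd_tail hT hmT hT0 hs hmono hs0 hi2 hi1 hM.symm hk hK hbS hz
            have b2 := fwd_tail hs hmono hs0 hT hmT hT0 hi1 hi2 hM hk hK hbT hz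
            rw [hwd] at b1
            rw [hwd'] at b2
            have e : ENNReal.ofReal (z ^ (p - r - 1)) =
                ENNReal.ofReal (z ^ (p - 1)) * ENNReal.ofReal (z ^ (-r)) := by
              rw [← ENNReal.ofReal_mul (by positivity), ← Real.rpow_add hz0]
              congr 2; ring
            rw [e, hC]
            calc _ ≤ ENNReal.ofReal (z ^ (p - 1)) * (ν {w | z ≤ |w|} + _ + _) :=
                  mul_le_mul_right (add_le_add (add_le_add le_rfl b1) b2) _
              _ = _ := by ring
        _ = (∫⁻ z in Ioi (1:ℝ), ν {w | z ≤ |w|} * ENNReal.ofReal (z ^ (p - 1))) +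
              C * ∫⁻ z in Ioi (1:ℝ), ν.withDensity d {w | z ≤ |w|} *
                ENNReal.ofReal (z ^ (p - r - 1)) := by
            rw [lintegral_add_left (meas_meas ν p), lintegral_const_mul _ (meas_meas _ _)]
        _ < ⊤ := by
            have hsub : Ioi (1:ℝ) ⊆ Ioi 0 := Ioi_subset_Ioi zero_le_one
            refine ENNReal.add_lt_top.2 ⟨(lintegral_mono_set hsub).trans_lt hL1, ?_⟩
            refine ENNReal.mul_lt_top ?_ ((lintegral_mono_set hsub).trans_lt hL2)
            exact ENNReal.mul_lt_top (by simp) ENNReal.ofReal_lt_top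
  · intro hfin
    rw [setLIntegral_congr_fun measurableSet_Ioi
      (fun z hz => integrand_eq s hs hmono hs0 ν hν0 hz p)] at hfin
    have hpm : ∫⁻ y, ENNReal.ofReal (|y| ^ p) ∂ν < ⊤ := by
      rw [lintegral_rpow_eq_lintegral_meas_le_mul ν (Eventually.of_forall fun y => abs_nonneg y)
        measurable_norm.aemeasurable hp]
      refine ENNReal.mul_lt_top ENNReal.ofReal_lt_top (lt_of_le_of_lt ?_ hfin)
      apply lintegral_mono
      intro z
      simp only
      rw [mul_comm, add_assoc]
      gcongr
      exact le_self_add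
    have hi : Integrable s ν := by
      have hip : Integrable (fun y : ℝ => |y| ^ p) ν :=
        (lintegral_ofReal_ne_top_iff_integrable (by
          apply Measurable.aestronglyMeasurable; fun_prop)
          (Eventually.of_forall fun y => by simp only [Pi.zero_apply]; positivity)).1 hpm.ne
      refine ((integrable_const (max |s 1| |s (-1)|)).add (hip.const_mul K)).mono'
        hs.aestronglyMeasurable (Eventually.of_forall fun y => ?_)
      simp only [Pi.add_apply, Real.norm_eq_abs]
      rcases le_total 1 |y| with hy | hy
      · have h1 := (hbound y hy).2
        have h2 := Real.rpow_le_rpow_of_exponent_le hy hpq.le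
        have h3 : 0 ≤ max |s 1| |s (-1)| := le_max_of_le_left (abs_nonneg _)
        nlinarith
      · have hy' := abs_le.1 hy
        have h1 := hmono.monotone hy'.1
        have h2 := hmono.monotone hy'.2
        have h3 : |s y| ≤ max |s 1| |s (-1)| := by
          rw [abs_le]
          constructor
          · have := neg_abs_le (s (-1))
            have := le_max_right |s 1| |s (-1)|
            linarith
          · exact h2.trans ((le_abs_self _).trans (le_max_left _ _))
        have : 0 ≤ K * |y| ^ p := by positivity
        linarith
    refine ⟨hpm, hi, ?_⟩
    have hi1 : IntegrableOn s (Ioi 0) ν := hi.integrableOn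
    have hi2 : IntegrableOn (rfs s) (Ioi 0) (ν.map Neg.neg) := (rfs_integrable hs hi).integrableOn
    have hfin1 := (lintegral_mono_set (Ioi_subset_Ioi (zero_le_one (α := ℝ)))).trans_lt hfin
    rw [integral_split hs hν0 hi, sub_eq_zero]
    rcases lt_trichotomy (∫ w in Ioi 0, s w ∂ν) (∫ w in Ioi 0, rfs s w ∂(ν.map Neg.neg))
      with h | h | h
    · exfalso
      have := conv_top hT hmT hT0 hs hmono hs0 hi2 hi1 h hK hq hpq (fun w hw => (hbS w hw).2)
      refine (lt_of_le_of_lt (lintegral_mono fun z => ?_) hfin1).ne this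
      simp only
      gcongr
      exact le_add_right le_add_self
    · exact h
    · exfalso
      have := conv_top hs hmono hs0 hT hmT hT0 hi1 hi2 h hK hq hpq (fun w hw => (hbT w hw).2)
      refine (lt_of_le_of_lt (lintegral_mono fun z => ?_) hfin1).ne this
      simp only
      gcongr
      exact le_add_self
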